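/- arXiv:1305.5746 — 2 statements merged into one kernel-verified Lean document; each statement's English description precedes it below -/
import Mathlib

section
/- Let φ : [0,∞) → ℝ and, for (ω₁,ω₂,ω₃) ∈ [0,∞)³, let ω₊ := max{ω₁,ω₂,ω₃}, ω₋ := min{ω₁,ω₂,ω₃}, and ω₀ the remaining (middle) value. Define H¹_φ(ω₁,ω₂,ω₃) := φ(ω₊ + ω₋ − ω₀) + φ(ω₊ + ω₀ − ω₋) − 2φ(ω₊) and H²_φ(ω₁,ω₂,ω₃) := φ(ω₊) + φ(ω₀ + ω₋ − ω₊) − φ(ω₀) − φ(ω₋). Then the function G_{0,φ}(ω₁,ω₂,ω₃) := (1/6) Σ_{π ∈ S₃} H_φ(ω_{π(1)}, ω_{π(2)}, ω_{π(3)}) Φ₀(ω_{π(1)}, ω_{π(2)}; ω_{π(3)}) satisfies the identity G_{0,φ}(ω₁,ω₂,ω₃) = (1/3)[ √ω₋ · H¹_φ(ω₁,ω₂,ω₃) + √((ω₀ + ω₋ − ω₊)₊) · H²_φ(ω₁,ω₂,ω₃) ]. Moreover, if φ is concave on [0,∞), then H¹_φ ≤ 0 and H²_φ ≤ 0 on [0,∞)³.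 -/
open Real

noncomputable section

/-- The minimum of the four square roots appearing in the collision kernel. -/
def Phi4 (σ a b c d : ℝ) : ℝ :=
  min (min (Real.sqrt (max (a - σ) 0)) (Real.sqrt (max (b - σ) 0)))
      (min (Real.sqrt (max (c - σ) 0)) (Real.sqrt (max (d - σ) 0)))

/-- `Φ_σ(ω₁,ω₂;ω₃) = min{√((ω₁-σ)₊), √((ω₂-σ)₊), √((ω₃-σ)₊), √((ω₁+ω₂-ω₃-σ)₊)}`. -/
def PhiSemi (σ ω₁ ω₂ ω₃ : ℝ) : ℝ := Phi4 σ ω₁ ω₂ ω₃ (ω₁ + ω₂ - ω₃)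

/-- `H_φ(x,y,z) = φ(z) + φ(x+y-z) - φ(x) - φ(y)`. -/
def Hfun (φ : ℝ → ℝ) (x y z : ℝ) : ℝ := φ z + φ (x + y - z) - φ x - φ y

/-- The symmetrized kernel `G_{σ,φ}`. -/
def Gsig (σ : ℝ) (φ : ℝ → ℝ) (ω₁ ω₂ ω₃ : ℝ) : ℝ :=
  (1/6) * ∑ pr : Equiv.Perm (Fin 3),
    Hfun φ (![ω₁, ω₂, ω₃] (pr 0)) (![ω₁, ω₂, ω₃] (pr 1)) (![ω₁, ω₂, ω₃] (pr 2)) *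
      PhiSemi σ (![ω₁, ω₂, ω₃] (pr 0)) (![ω₁, ω₂, ω₃] (pr 1)) (![ω₁, ω₂, ω₃] (pr 2))

/-- The largest of three reals. -/
def wmax (a b c : ℝ) : ℝ := max a (max b c)

/-- The smallest of three reals. -/
def wmin (a b c : ℝ) : ℝ := min a (min b c)

/-- The middle one of three reals. -/
def wmid (a b c : ℝ) : ℝ := a + b + c - wmax a b c - wmin a b c

/-- `H¹_φ = φ(ω₊+ω₋-ω₀) + φ(ω₊+ω₀-ω₋) - 2φ(ω₊)`. -/
def H1 (φ : ℝ → ℝ) (a b c : ℝ) : ℝ :=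
  φ (wmax a b c + wmin a b c - wmid a b c) + φ (wmax a b c + wmid a b c - wmin a b c)
    - 2 * φ (wmax a b c)

/-- `H²_φ = φ(ω₊) + φ(ω₀+ω₋-ω₊) - φ(ω₀) - φ(ω₋)`. -/
def H2 (φ : ℝ → ℝ) (a b c : ℝ) : ℝ :=
  φ (wmax a b c) + φ (wmid a b c + wmin a b c - wmax a b c) - φ (wmid a b c) - φ (wmin a b c)

/-- For a concave function, the outer pair of points has the smaller sum of values. -/
theorem ConcaveOn.add_le_add_of_mem_Icc {φ : ℝ → ℝ} {S : Set ℝ} (hφ : ConcaveOn ℝ S φ)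
    {s p x y : ℝ} (hs : s ∈ S) (hp : p ∈ S) (hx : x ∈ Set.Icc s p) (h : x + y = s + p) :
    φ s + φ p ≤ φ x + φ y := by
  obtain ⟨hsx, hxp⟩ := hx
  rcases (hsx.trans hxp).eq_or_lt with rfl | hlt
  · obtain rfl : x = s := le_antisymm hxp hsx
    obtain rfl : y = x := by linarith
    exact le_rfl
  · have hd : 0 < p - s := sub_pos.2 hlt
    have h0 : 0 ≤ (p - x) / (p - s) := div_nonneg (by linarith) hd.le
    have h1 : 0 ≤ (x - s) / (p - s) := div_nonneg (by linarith) hd.le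
    have hsum : (p - x) / (p - s) + (x - s) / (p - s) = 1 := by
      field_simp
      ring
    have hx' := hφ.2 hs hp h0 h1 hsum
    have hy' := hφ.2 hs hp h1 h0 (by rw [add_comm]; exact hsum)
    have ex : (p - x) / (p - s) * s + (x - s) / (p - s) * p = x := by
      field_simp
      ring
    have ey : (x - s) / (p - s) * s + (p - x) / (p - s) * p = y := by
      linear_combination (s + p) * hsum - ex - h
    simp only [smul_eq_mul] at hx' hy'
    rw [ex] at hx'
    rw [ey] at hy'
    linear_combination hx' + hy' - (φ s + φ p) * hsum

theorem Hfun_comm (φ : ℝ → ℝ) (x y z : ℝ) : Hfun φ x y z = Hfun φ y x z := by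
  simp only [Hfun, add_comm x y]
  ring

theorem PhiSemi_comm (σ x y z : ℝ) : PhiSemi σ x y z = PhiSemi σ y x z := by
  simp only [PhiSemi, Phi4, add_comm x y, min_comm (√(max (x - σ) 0))]

/-- The symmetrized kernel as a sum over the choice of the distinguished third argument. -/
theorem Gsig_eq (σ : ℝ) (φ : ℝ → ℝ) (a b c : ℝ) :
    Gsig σ φ a b c = (1/3) * (Hfun φ a b c * PhiSemi σ a b c +
      Hfun φ a c b * PhiSemi σ a c b + Hfun φ b c a * PhiSemi σ b c a) := by
  rw [Gsig, ← Equiv.sum_comp (Equiv.Perm.decomposeFin (n := 2)).symm, Fintype.sum_prod_type]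
  have hsum (f : Equiv.Perm (Fin 2) → ℝ) : ∑ q, f q = f 1 + f (Equiv.swap 0 1) := by
    rw [show (Finset.univ : Finset (Equiv.Perm (Fin 2))) = {1, Equiv.swap 0 1} by decide,
      Finset.sum_pair (by decide)]
  have e₁ (i : Fin 3) (q : Equiv.Perm (Fin 2)) :
      Equiv.Perm.decomposeFin.symm (i, q) 1 = Equiv.swap 0 i (q 0).succ :=
    Equiv.Perm.decomposeFin_symm_apply_succ q i 0
  have e₂ (i : Fin 3) (q : Equiv.Perm (Fin 2)) :
      Equiv.Perm.decomposeFin.symm (i, q) 2 = Equiv.swap 0 i (q 1).succ :=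
    Equiv.Perm.decomposeFin_symm_apply_succ q i 1
  have s₁ : Equiv.swap (0 : Fin 3) 1 2 = 2 := by decide
  have s₂ : Equiv.swap (0 : Fin 3) 2 1 = 1 := by decide
  simp [Fin.sum_univ_three, hsum, e₁, e₂, s₁, s₂]
  rw [Hfun_comm φ b a c, Hfun_comm φ c a b, Hfun_comm φ c b a,
    PhiSemi_comm σ b a c, PhiSemi_comm σ c a b, PhiSemi_comm σ c b a]
  ring

/-- The representation formula for ordered arguments. -/
theorem sum_Hfun_mul_PhiSemi_of_le (φ : ℝ → ℝ) {n m p : ℝ} (hn : 0 ≤ n) (hnm : n ≤ m)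
    (hmp : m ≤ p) :
    Hfun φ n m p * PhiSemi 0 n m p + Hfun φ n p m * PhiSemi 0 n p m +
        Hfun φ m p n * PhiSemi 0 m p n =
      √n * (φ (p + n - m) + φ (p + m - n) - 2 * φ p) +
        √(max (m + n - p) 0) * (φ p + φ (m + n - p) - φ m - φ n) := by
  have hm := hn.trans hnm
  have hp := hm.trans hmp
  have k1 : PhiSemi 0 n m p = √(max (m + n - p) 0) := by
    simp only [PhiSemi, Phi4, sub_zero, max_eq_left hn, max_eq_left hm, max_eq_left hp]
    rw [add_comm m n, min_eq_left (Real.sqrt_le_sqrt hnm), min_eq_right (a := √p),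
      min_eq_right]
    · exact Real.sqrt_le_sqrt (max_le (by linarith) hn)
    · exact Real.sqrt_le_sqrt (max_le (by linarith) hp)
  have k2 : PhiSemi 0 n p m = √n := by
    simp only [PhiSemi, Phi4, sub_zero, max_eq_left hn, max_eq_left hm, max_eq_left hp]
    rw [min_eq_left (Real.sqrt_le_sqrt (hnm.trans hmp)), min_eq_left]
    exact le_min (Real.sqrt_le_sqrt hnm)
      (Real.sqrt_le_sqrt (le_max_of_le_left (by linarith)))
  have k3 : PhiSemi 0 m p n = √n := by
    simp only [PhiSemi, Phi4, sub_zero, max_eq_left hn, max_eq_left hm, max_eq_left hp]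
    rw [min_eq_left (Real.sqrt_le_sqrt hmp), min_eq_left (a := √n), min_eq_right]
    · exact Real.sqrt_le_sqrt hnm
    · exact Real.sqrt_le_sqrt (le_max_of_le_left (by linarith))
  rw [k1, k2, k3]
  simp only [Hfun, add_comm n, add_comm m p]
  ring

theorem wmin_nonneg {a b c : ℝ} (ha : 0 ≤ a) (hb : 0 ≤ b) (hc : 0 ≤ c) : 0 ≤ wmin a b c :=
  le_min ha (le_min hb hc)

theorem wmin_le_wmid (a b c : ℝ) : wmin a b c ≤ wmid a b c := by
  simp only [wmid, wmin, wmax]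
  grind

theorem wmid_le_wmax (a b c : ℝ) : wmid a b c ≤ wmax a b c := by
  simp only [wmid, wmin, wmax]
  grind

/-- A symmetric function of three reals may be evaluated at the sorted triple. -/
theorem apply_wmin_wmid_wmax {α : Type*} (F : ℝ → ℝ → ℝ → α) (h₁ : ∀ x y z, F x y z = F y x z)
    (h₂ : ∀ x y z, F x y z = F x z y) (a b c : ℝ) :
    F (wmin a b c) (wmid a b c) (wmax a b c) = F a b c := by
  have key : ∀ x y z, wmin a b c = x → wmax a b c = z → a + b + c = x + y + z →
      F (wmin a b c) (wmid a b c) (wmax a b c) = F x y z := by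
    rintro x y z hx hz hs
    rw [wmid, hx, hz, show a + b + c - z - x = y by linarith]
  rcases le_total a b with hab | hab <;> rcases le_total b c with hbc | hbc <;>
    rcases le_total a c with hac | hac
  all_goals simp only [wmin, wmax] at key
  · exact key a b c (by grind) (by grind) (by ring)
  · exact key a b c (by grind) (by grind) (by ring)
  · exact (key a c b (by grind) (by grind) (by ring)).trans (h₂ _ _ _)
  · exact (key c a b (by grind) (by grind) (by ring)).trans ((h₁ _ _ _).trans (h₂ _ _ _))
  · exact (key b a c (by grind) (by grind) (by ring)).trans (h₁ _ _ _)
  · exact (key b c a (by grind) (by grind) (by ring)).trans ((h₂ _ _ _).trans (h₁ _ _ _))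
  · exact (key c b a (by grind) (by grind) (by ring)).trans
      ((h₂ _ _ _).trans ((h₁ _ _ _).trans (h₂ _ _ _)))
  · exact (key c b a (by grind) (by grind) (by ring)).trans
      ((h₂ _ _ _).trans ((h₁ _ _ _).trans (h₂ _ _ _)))

/-- Representation formula for `G_{0,φ}` and nonpositivity of `H¹_φ`, `H²_φ`
for concave `φ` (Lemma 2.18). -/
theorem Gzero_representation (φ : ℝ → ℝ) :
    (∀ a b c : ℝ, 0 ≤ a → 0 ≤ b → 0 ≤ c →
      Gsig 0 φ a b c =
        (1/3) * (Real.sqrt (wmin a b c) * H1 φ a b c +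
          Real.sqrt (max (wmid a b c + wmin a b c - wmax a b c) 0) * H2 φ a b c)) ∧
    (ConcaveOn ℝ (Set.Ici 0) φ →
      (∀ a b c : ℝ, 0 ≤ a → 0 ≤ b → 0 ≤ c → H1 φ a b c ≤ 0) ∧
      (∀ a b c : ℝ, 0 ≤ a → 0 ≤ b → 0 ≤ c →
        0 ≤ wmid a b c + wmin a b c - wmax a b c → H2 φ a b c ≤ 0)) := by
  refine ⟨fun a b c ha hb hc => ?_, fun hφ => ⟨fun a b c ha hb hc => ?_,
    fun a b c ha hb hc h => ?_⟩⟩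
  · have hsymm := apply_wmin_wmid_wmax (Gsig 0 φ)
      (fun x y z => by
        rw [Gsig_eq, Gsig_eq, Hfun_comm φ y x z, PhiSemi_comm 0 y x z]
        ring)
      (fun x y z => by
        rw [Gsig_eq, Gsig_eq, Hfun_comm φ z y x, PhiSemi_comm 0 z y x]
        ring) a b c
    rw [← hsymm, Gsig_eq, sum_Hfun_mul_PhiSemi_of_le φ (wmin_nonneg ha hb hc)
      (wmin_le_wmid a b c) (wmid_le_wmax a b c), H1, H2]
  · have h0 := wmin_nonneg ha hb hc
    have h1 := wmin_le_wmid a b c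
    have h2 := wmid_le_wmax a b c
    have := hφ.add_le_add_of_mem_Icc (s := wmax a b c + wmin a b c - wmid a b c)
      (p := wmax a b c + wmid a b c - wmin a b c) (x := wmax a b c) (y := wmax a b c)
      (Set.mem_Ici.2 (by linarith)) (Set.mem_Ici.2 (by linarith))
      ⟨by linarith, by linarith⟩ (by ring)
    rw [H1]
    linarith
  · have h0 := wmin_nonneg ha hb hc
    have h1 := wmin_le_wmid a b c
    have h2 := wmid_le_wmax a b c
    have := hφ.add_le_add_of_mem_Icc (s := wmid a b c + wmin a b c - wmax a b c)
      (p := wmax a b c) (x := wmid a b c) (y := wmin a b c)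
      h (Set.mem_Ici.2 (by linarith)) ⟨by linarith, by linarith⟩ (by ring)
    rw [H2]
    linarith
end
end

section
/- Let A be a nonempty closed subset of [0,∞), let A* be its extended set, and let R* := inf(A*). If R* > 0, then A* = { R* + Σ_{k=1}^L n_k D_k : n_k ∈ ℕ } for a finite set {D_k}_{k=1}^L of positive reals with rational pairwise quotients and min_k D_k ≥ R*. If R* = 0, then the closure of A* equals [0,∞). -/
open Set Pointwise

noncomputable section

/-- The iterates `A₁ = A`, `A_{n+1} = (A_n + A_n - A_n) ∩ (0,∞)` (pointwise set operations). -/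
def iterSet (A : Set ℝ) : ℕ → Set ℝ
  | 0 => A
  | n + 1 => (iterSet A n + iterSet A n - iterSet A n) ∩ Set.Ioi 0

/-- The extended set `A*`. -/
def extSet (A : Set ℝ) : Set ℝ := ⋃ n : ℕ, iterSet A (n + 1)

theorem iterSet_pos {A : Set ℝ} {n : ℕ} {x : ℝ} (hx : x ∈ iterSet A (n + 1)) : 0 < x :=
  hx.2

theorem extSet_pos {A : Set ℝ} {x : ℝ} (hx : x ∈ extSet A) : 0 < x := by
  obtain ⟨n, hn⟩ := mem_iUnion.1 hx
  exact iterSet_pos hn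

theorem monotone_iterSet_succ (A : Set ℝ) : Monotone fun n => iterSet A (n + 1) :=
  monotone_nat_of_le_succ fun _ x hx =>
    ⟨⟨x + x, add_mem_add hx hx, x, hx, add_sub_cancel_right x x⟩, iterSet_pos hx⟩

/-- The extended set is closed under `x + y - z` as long as the result is positive. -/
theorem add_sub_mem_extSet {A : Set ℝ} {x y z : ℝ} (hx : x ∈ extSet A) (hy : y ∈ extSet A)
    (hz : z ∈ extSet A) (hpos : 0 < x + y - z) : x + y - z ∈ extSet A := by
  obtain ⟨i, hi⟩ := mem_iUnion.1 hx
  obtain ⟨j, hj⟩ := mem_iUnion.1 hy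
  obtain ⟨k, hk⟩ := mem_iUnion.1 hz
  have hmono := monotone_iterSet_succ A
  refine mem_iUnion.2 ⟨max i (max j k) + 1, ⟨x + y, add_mem_add ?_ ?_, z, ?_, rfl⟩, hpos⟩
  · exact hmono (le_max_left i (max j k)) hi
  · exact hmono ((le_max_left j k).trans (le_max_right i _)) hj
  · exact hmono ((le_max_right j k).trans (le_max_right i _)) hk

theorem add_nat_mul_sub_mem_extSet {A : Set ℝ} {x y z : ℝ} (hx : x ∈ extSet A)
    (hy : y ∈ extSet A) (hz : z ∈ extSet A) (hzy : z ≤ y) (n : ℕ) :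
    x + n * (y - z) ∈ extSet A := by
  induction n with
  | zero => simpa using hx
  | succ n ih =>
    have hpos := extSet_pos ih
    convert add_sub_mem_extSet ih hy hz (by linarith) using 1
    push_cast
    ring

theorem bddBelow_extSet (A : Set ℝ) : BddBelow (extSet A) :=
  ⟨0, fun _ hx => (extSet_pos hx).le⟩

theorem sInf_extSet_le_sub {A : Set ℝ} {x y : ℝ} (hx : x ∈ extSet A) (hy : y ∈ extSet A)
    (hxy : x < y) : sInf (extSet A) ≤ y - x := by
  by_contra! hlt
  have hle {z : ℝ} (hz : z ∈ extSet A) : sInf (extSet A) ≤ z := csInf_le (bddBelow_extSet A) hz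
  have hmem (n : ℕ) : x - n * (y - x) ∈ extSet A := by
    induction n with
    | zero => simpa using hx
    | succ n ih =>
      have := hle ih
      convert add_sub_mem_extSet ih hx hy (by linarith) using 1
      push_cast
      ring
  obtain ⟨n, hn⟩ := exists_nat_gt (x / (y - x))
  rw [div_lt_iff₀ (sub_pos.2 hxy)] at hn
  linarith [extSet_pos (hmem n)]

/-- A nonempty set of reals that is bounded below and uniformly separated has a least element. -/
theorem csInf_mem_of_le_sub {S : Set ℝ} {δ : ℝ} (hδ : 0 < δ) (hne : S.Nonempty)
    (hbdd : BddBelow S) (hsep : ∀ x ∈ S, ∀ y ∈ S, x < y → δ ≤ y - x) : sInf S ∈ S := by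
  obtain ⟨y, hy, hyδ⟩ := exists_lt_of_csInf_lt hne (lt_add_of_pos_right (sInf S) hδ)
  rcases (csInf_le hbdd hy).eq_or_lt with heq | hlt
  · rwa [heq]
  · obtain ⟨z, hz, hzy⟩ := exists_lt_of_csInf_lt hne hlt
    linarith [hsep z hz y hy hzy, csInf_le hbdd hz]

theorem sInf_extSet_mem {A : Set ℝ} (hne : (extSet A).Nonempty) (hR : 0 < sInf (extSet A)) :
    sInf (extSet A) ∈ extSet A :=
  csInf_mem_of_le_sub hR hne (bddBelow_extSet A) fun _ hx _ hy => sInf_extSet_le_sub hx hy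

/-- If `R* > 0`, the extended set is a singleton or an infinite arithmetic progression. -/
theorem extSet_eq_singleton_or_progression {A : Set ℝ} (hne : (extSet A).Nonempty)
    (hR : 0 < sInf (extSet A)) :
    extSet A = {sInf (extSet A)} ∨ ∃ d : ℝ, sInf (extSet A) ≤ d ∧
      extSet A = range fun n : ℕ => sInf (extSet A) + n * d := by
  have hmem := sInf_extSet_mem hne hR
  have hle {z : ℝ} (hz : z ∈ extSet A) : sInf (extSet A) ≤ z := csInf_le (bddBelow_extSet A) hz
  set R := sInf (extSet A)
  set S := extSet A ∩ Ioi R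
  have hSbdd : BddBelow S := (bddBelow_extSet A).mono inter_subset_left
  rcases S.eq_empty_or_nonempty with hempty | hSne
  · refine Or.inl (Subset.antisymm (fun x hx => ?_) (singleton_subset_iff.2 hmem))
    by_contra hxR
    have : x ∈ S := ⟨hx, lt_of_le_of_ne (hle hx) (Ne.symm hxR)⟩
    simp [hempty] at this
  · obtain ⟨he, hRe⟩ : sInf S ∈ S := csInf_mem_of_le_sub hR hSne hSbdd
      fun _ hx _ hy => sInf_extSet_le_sub hx.1 hy.1
    have hd : 0 < sInf S - R := sub_pos.2 hRe
    have hprog (n : ℕ) : R + n * (sInf S - R) ∈ extSet A :=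
      add_nat_mul_sub_mem_extSet hmem he hmem hRe.le n
    refine Or.inr ⟨sInf S - R, sInf_extSet_le_sub hmem he hRe,
      Subset.antisymm (fun x hx => ?_) (range_subset_iff.2 hprog)⟩
    set n := ⌊(x - R) / (sInf S - R)⌋₊
    have hn_le : n * (sInf S - R) ≤ x - R :=
      (le_div_iff₀ hd).1 (Nat.floor_le (div_nonneg (sub_nonneg.2 (hle hx)) hd.le))
    have hn_lt : x - R < (n + 1) * (sInf S - R) := (div_lt_iff₀ hd).1 (Nat.lt_floor_add_one _)
    have hrem : x + R - (R + n * (sInf S - R)) ∈ extSet A :=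
      add_sub_mem_extSet hx hmem (hprog n) (by linarith)
    refine ⟨n, le_antisymm (by linarith) ?_⟩
    by_contra! hlt
    linarith [csInf_le hSbdd ⟨hrem, mem_Ioi.2 (by linarith)⟩]

theorem closure_extSet_of_sInf_eq_zero {A : Set ℝ} (hne : (extSet A).Nonempty)
    (hR : sInf (extSet A) = 0) : closure (extSet A) = Ici 0 := by
  refine Subset.antisymm (closure_minimal (fun x hx => (extSet_pos hx).le) isClosed_Ici)
    fun t ht => Metric.mem_closure_iff.2 fun ε hε => ?_
  obtain ⟨b, hb, hbε⟩ := exists_lt_of_csInf_lt hne (hR.trans_lt hε)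
  obtain ⟨c, hc, hcb⟩ := exists_lt_of_csInf_lt hne (hR.trans_lt (extSet_pos hb))
  have hd : 0 < b - c := sub_pos.2 hcb
  have hc0 := extSet_pos hc
  refine ⟨_, add_nat_mul_sub_mem_extSet hc hb hc hcb.le ⌊t / (b - c)⌋₊, ?_⟩
  have hn_le := (le_div_iff₀ hd).1 (Nat.floor_le (div_nonneg ht hd.le))
  have hn_lt := (div_lt_iff₀ hd).1 (Nat.lt_floor_add_one (t / (b - c)))
  rw [Real.dist_eq, abs_lt]
  constructor <;> linarith

/-- Structure of the extended set: lattice structure if `R* > 0`, density if `R* = 0`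
(Corollary 3.7). -/
theorem extended_set_dichotomy
    (A : Set ℝ) (hne : A.Nonempty) (hcl : IsClosed A) (hsub : A ⊆ Set.Ici 0)
    (hne' : (extSet A).Nonempty) :
    (0 < sInf (extSet A) →
      ∃ (L : ℕ) (D : Fin L → ℝ),
        (∀ k, 0 < D k) ∧
        extSet A = {x : ℝ | ∃ n : Fin L → ℕ, x = sInf (extSet A) + ∑ k, (n k : ℝ) * D k} ∧
        (∀ j k, ∃ q : ℚ, D j / D k = (q : ℝ)) ∧
        (∀ k, sInf (extSet A) ≤ D k)) ∧
    (sInf (extSet A) = 0 → closure (extSet A) = Set.Ici 0) := by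
  refine ⟨fun hR => ?_, closure_extSet_of_sInf_eq_zero hne'⟩
  rcases extSet_eq_singleton_or_progression hne' hR with heq | ⟨d, hRd, heq⟩
  · refine ⟨0, Fin.elim0, fun k => k.elim0, ?_, fun k => k.elim0, fun k => k.elim0⟩
    refine heq.trans ?_
    ext x
    simp
  · have hd : 0 < d := hR.trans_le hRd
    refine ⟨1, fun _ => d, fun _ => hd, ?_, fun _ _ => ⟨1, by simp [hd.ne']⟩, fun _ => hRd⟩
    refine heq.trans ?_
    ext x
    simp only [mem_range, mem_ofPred_eq, Fin.sum_univ_one]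
    exact ⟨fun ⟨n, hn⟩ => ⟨fun _ => n, hn.symm⟩, fun ⟨n, hn⟩ => ⟨n 0, hn.symm⟩⟩
end
end
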